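/- arXiv:1309.6049 — 5 statements merged into one kernel-verified Lean document; each statement's English description precedes it below -/
import Mathlib

section
/- There exists a ℤ-algebra homomorphism G : Cl_ℤ → End_ℤ(V) with G(a_{2j}) = η_j and G(a_{2j−1}) = η_j^* + η_{j−1}^* for all j ∈ ℤ; that is, the endomorphisms b_{2j} := η_j and b_{2j−1} := η_j^* + η_{j−1}^* of V satisfy b_m² = 0, b_m b_l = −b_l b_m whenever |m − l| > 1, and b_m b_{m+1} + b_{m+1} b_m = id_V for all m, l ∈ ℤ. -/
/-!
The integral Clifford algebra `Cl_ℤ`: the quotient of the free ℤ-algebra on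
generators `a i` (`i : ℤ`) by the relations `aᵢ² = 0`, `aᵢaⱼ = -aⱼaᵢ` for
`|i - j| > 1`, and `aᵢa_{i+1} + a_{i+1}aᵢ = 1`.
-/

/-- The defining relations of the integral Clifford algebra. -/
inductive ClRel : FreeAlgebra ℤ ℤ → FreeAlgebra ℤ ℤ → Prop
  | sq (i : ℤ) : ClRel (FreeAlgebra.ι ℤ i * FreeAlgebra.ι ℤ i) 0
  | anticomm (i j : ℤ) : 1 < |i - j| →
      ClRel (FreeAlgebra.ι ℤ i * FreeAlgebra.ι ℤ j) (-(FreeAlgebra.ι ℤ j * FreeAlgebra.ι ℤ i))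
  | adjacent (i : ℤ) :
      ClRel (FreeAlgebra.ι ℤ i * FreeAlgebra.ι ℤ (i + 1)
        + FreeAlgebra.ι ℤ (i + 1) * FreeAlgebra.ι ℤ i) 1

/-- The integral Clifford algebra `Cl_ℤ`. -/
abbrev ClZ : Type := RingQuot ClRel

/-- The generator `aᵢ` of `Cl_ℤ`. -/
noncomputable def a (i : ℤ) : ClZ := RingQuot.mkAlgHom ℤ ClRel (FreeAlgebra.ι ℤ i)

/-!
Fock space `V`: free ℤ-module with basis the set `𝔹` of semi-infinite increasing
sequences of even integers.  A basis element is encoded by the set of its entries: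
a set of even integers which is bounded below and contains every sufficiently
large even integer.  The wedging operator `eta j` inserts `2*j` (with sign
`(-1)^(number of entries below 2*j)`) and the contracting operator `etaStar j`
removes `2*j` (with the corresponding sign).
-/

open scoped Classical

/-- A set of integers encoding a semi-infinite strictly increasing sequence of even
integers `x₁ < x₂ < ⋯` with `xₙ = 2n + 2k` for `n ≫ 0`:  all elements are even, the
set is bounded below, and it contains every sufficiently large even integer. -/
def IsFock (S : Set ℤ) : Prop :=
  (∀ s ∈ S, Even s) ∧ (∃ a : ℤ, ∀ s ∈ S, a ≤ s) ∧
    (∃ b : ℤ, ∀ m : ℤ, Even m → b ≤ m → m ∈ S)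

/-- The basis `𝔹` of semi-infinite monomials. -/
def FockBasis : Type := {S : Set ℤ // IsFock S}

/-- `V`, the free ℤ-module on `𝔹`. -/
abbrev V : Type := FockBasis →₀ ℤ

theorem IsFock.insert {S : Set ℤ} (h : IsFock S) (j : ℤ) : IsFock (insert (2 * j) S) := by
  obtain ⟨he, ⟨a, ha⟩, ⟨b, hb⟩⟩ := h
  refine ⟨?_, ⟨min a (2 * j), ?_⟩, ⟨b, ?_⟩⟩
  · rintro s (rfl | hs)
    · exact ⟨j, two_mul j⟩
    · exact he s hs
  · rintro s (rfl | hs)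
    · exact min_le_right _ _
    · exact le_trans (min_le_left _ _) (ha s hs)
  · intro m hm hbm
    exact Set.mem_insert_of_mem _ (hb m hm hbm)

theorem IsFock.diff {S : Set ℤ} (h : IsFock S) (j : ℤ) : IsFock (S \ {2 * j}) := by
  obtain ⟨he, ⟨a, ha⟩, ⟨b, hb⟩⟩ := h
  refine ⟨?_, ⟨a, ?_⟩, ⟨max b (2 * j + 1), ?_⟩⟩
  · exact fun s hs => he s hs.1
  · exact fun s hs => ha s hs.1
  · intro m hm hbm
    refine ⟨hb m hm (le_trans (le_max_left _ _) hbm), ?_⟩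
    have : 2 * j + 1 ≤ m := le_trans (le_max_right _ _) hbm
    simp only [Set.mem_singleton_iff]
    omega

/-- The wedging operator `η_j` on `V`. -/
noncomputable def eta (j : ℤ) : Module.End ℤ V :=
  Finsupp.linearCombination ℤ fun x : FockBasis =>
    if 2 * j ∈ x.1 then 0
    else ((-1 : ℤ) ^ {s ∈ x.1 | s < 2 * j}.ncard) •
      Finsupp.single (⟨insert (2 * j) x.1, x.2.insert j⟩ : FockBasis) (1 : ℤ)

/-- The contracting operator `η_j^*` on `V`. -/
noncomputable def etaStar (j : ℤ) : Module.End ℤ V :=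
  Finsupp.linearCombination ℤ fun x : FockBasis =>
    if 2 * j ∈ x.1 then
      ((-1 : ℤ) ^ {s ∈ x.1 | s < 2 * j}.ncard) •
        Finsupp.single (⟨x.1 \ {2 * j}, x.2.diff j⟩ : FockBasis) (1 : ℤ)
    else 0

open scoped Classical in
/-- The family of endomorphisms `b_m` of `V`: `b_{2j} = η_j` and
`b_{2j-1} = η_j^* + η_{j-1}^*`. -/
noncomputable def bV (m : ℤ) : Module.End ℤ V :=
  if Even m then eta (m / 2) else etaStar ((m + 1) / 2) + etaStar ((m + 1) / 2 - 1)

theorem IsFock.finite_lt {S : Set ℤ} (h : IsFock S) (n : ℤ) : {s ∈ S | s < n}.Finite := by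
  obtain ⟨-, ⟨a, ha⟩, -⟩ := h
  exact (Set.finite_Ico a n).subset fun s hs => ⟨ha s hs.1, hs.2⟩

/-- The sign `(-1)^(number of entries below 2*j)` of a semi-infinite monomial. -/
noncomputable def fockSign (S : Set ℤ) (j : ℤ) : ℤ := (-1) ^ {s ∈ S | s < 2 * j}.ncard

theorem fockSign_mul_self (S : Set ℤ) (j : ℤ) : fockSign S j * fockSign S j = 1 := by
  rw [fockSign, ← mul_pow]
  simp

theorem fockSign_insert {S : Set ℤ} (h : IsFock S) {i : ℤ} (hi : 2 * i ∉ S) (j : ℤ) :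
    fockSign (insert (2 * i) S) j = if i < j then -fockSign S j else fockSign S j := by
  unfold fockSign
  split_ifs with hij
  · have : {s ∈ insert (2 * i) S | s < 2 * j} = insert (2 * i) {s ∈ S | s < 2 * j} := by
      ext s
      simp only [Set.mem_insert_iff, Set.mem_ofPred_eq]
      grind
    rw [this, Set.ncard_insert_of_notMem (fun hs => hi hs.1) (h.finite_lt _), pow_succ]
    ring
  · congr 2
    ext s
    simp only [Set.mem_insert_iff, Set.mem_ofPred_eq]
    grind

theorem fockSign_diff {S : Set ℤ} (h : IsFock S) {i : ℤ} (hi : 2 * i ∈ S) (j : ℤ) :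
    fockSign (S \ {2 * i}) j = if i < j then -fockSign S j else fockSign S j := by
  have key := fockSign_insert (h.diff i) (i := i) (by simp) j
  rw [Set.insert_sdiff_singleton, Set.insert_eq_of_mem hi] at key
  rw [key]
  split_ifs <;> simp

namespace FockBasis

/-- The set of entries of a semi-infinite monomial. -/
def entries (x : FockBasis) : Set ℤ := x.1

theorem isFock_entries (x : FockBasis) : IsFock x.entries := x.2

theorem entries_injective : Function.Injective entries := Subtype.val_injective

/-- The semi-infinite monomial obtained by adding the entry `2 * j`. -/
def insert (j : ℤ) (x : FockBasis) : FockBasis := ⟨Insert.insert (2 * j) x.entries, x.2.insert j⟩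

/-- The semi-infinite monomial obtained by removing the entry `2 * j`. -/
def erase (j : ℤ) (x : FockBasis) : FockBasis := ⟨x.entries \ {2 * j}, x.2.diff j⟩

@[simp]
theorem entries_insert (j : ℤ) (x : FockBasis) :
    (x.insert j).entries = Insert.insert (2 * j) x.entries := rfl

@[simp]
theorem entries_erase (j : ℤ) (x : FockBasis) : (x.erase j).entries = x.entries \ {2 * j} := rfl

theorem insert_comm (i j : ℤ) (x : FockBasis) : (x.insert j).insert i = (x.insert i).insert j :=
  entries_injective (by simp [Set.insert_comm])

theorem erase_comm (i j : ℤ) (x : FockBasis) : (x.erase j).erase i = (x.erase i).erase j :=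
  entries_injective (by simp [Set.sdiff_sdiff_comm])

theorem insert_erase_comm {i j : ℤ} (hij : i ≠ j) (x : FockBasis) :
    (x.erase j).insert i = (x.insert i).erase j :=
  entries_injective (by ext; simp; grind)

theorem insert_erase_self {j : ℤ} {x : FockBasis} (hj : 2 * j ∈ x.entries) :
    (x.erase j).insert j = x :=
  entries_injective (by ext; simp; grind)

theorem erase_insert_self {j : ℤ} {x : FockBasis} (hj : 2 * j ∉ x.entries) :
    (x.insert j).erase j = x :=
  entries_injective (by ext; simp; grind)

end FockBasis

theorem eta_single_of_mem {j : ℤ} {x : FockBasis} (hj : 2 * j ∈ x.entries) :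
    eta j (Finsupp.single x 1) = 0 := by
  rw [eta, Finsupp.linearCombination_single, one_smul]
  exact if_pos hj

theorem eta_single_of_notMem {j : ℤ} {x : FockBasis} (hj : 2 * j ∉ x.entries) :
    eta j (Finsupp.single x 1) = fockSign x.entries j • Finsupp.single (x.insert j) (1 : ℤ) := by
  rw [eta, Finsupp.linearCombination_single, one_smul]
  exact if_neg hj

theorem etaStar_single_of_mem {j : ℤ} {x : FockBasis} (hj : 2 * j ∈ x.entries) :
    etaStar j (Finsupp.single x 1) =
      fockSign x.entries j • Finsupp.single (x.erase j) (1 : ℤ) := by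
  rw [etaStar, Finsupp.linearCombination_single, one_smul]
  exact if_pos hj

theorem etaStar_single_of_notMem {j : ℤ} {x : FockBasis} (hj : 2 * j ∉ x.entries) :
    etaStar j (Finsupp.single x 1) = 0 := by
  rw [etaStar, Finsupp.linearCombination_single, one_smul]
  exact if_neg hj

theorem V_end_ext {f g : Module.End ℤ V}
    (h : ∀ x : FockBasis, f (Finsupp.single x 1) = g (Finsupp.single x 1)) : f = g :=
  Finsupp.basisSingleOne.ext fun x => by simpa using h x

theorem eta_mul_self (j : ℤ) : eta j * eta j = 0 := by
  refine V_end_ext fun x => ?_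
  rw [Module.End.mul_apply, LinearMap.zero_apply]
  by_cases hj : 2 * j ∈ x.entries
  · rw [eta_single_of_mem hj, map_zero]
  · rw [eta_single_of_notMem hj, map_smul, eta_single_of_mem (by simp), smul_zero]

theorem etaStar_mul_self (j : ℤ) : etaStar j * etaStar j = 0 := by
  refine V_end_ext fun x => ?_
  rw [Module.End.mul_apply, LinearMap.zero_apply]
  by_cases hj : 2 * j ∈ x.entries
  · rw [etaStar_single_of_mem hj, map_smul, etaStar_single_of_notMem (by simp), smul_zero]
  · rw [etaStar_single_of_notMem hj, map_zero]

theorem eta_mul_eta (i j : ℤ) : eta i * eta j = -(eta j * eta i) := by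
  rcases eq_or_ne i j with rfl | hij
  · rw [eta_mul_self, neg_zero]
  refine V_end_ext fun x => ?_
  rw [LinearMap.neg_apply, Module.End.mul_apply, Module.End.mul_apply]
  by_cases hi : 2 * i ∈ x.entries <;> by_cases hj : 2 * j ∈ x.entries
  · rw [eta_single_of_mem hi, eta_single_of_mem hj, map_zero, map_zero, neg_zero]
  · rw [eta_single_of_mem hi, eta_single_of_notMem hj, map_zero, map_smul,
      eta_single_of_mem (by simp [hi]), smul_zero, neg_zero]
  · rw [eta_single_of_notMem hi, eta_single_of_mem hj, map_zero, map_smul,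
      eta_single_of_mem (by simp [hj]), smul_zero, neg_zero]
  · rw [eta_single_of_notMem hi, eta_single_of_notMem hj, map_smul, map_smul,
      eta_single_of_notMem (by simp [hi, hij]), eta_single_of_notMem (by simp [hj, hij.symm]),
      FockBasis.insert_comm, smul_smul, smul_smul, ← neg_smul, FockBasis.entries_insert,
      FockBasis.entries_insert, fockSign_insert x.isFock_entries hi,
      fockSign_insert x.isFock_entries hj]
    congr 1
    grind

theorem etaStar_mul_etaStar (i j : ℤ) : etaStar i * etaStar j = -(etaStar j * etaStar i) := by
  rcases eq_or_ne i j with rfl | hij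
  · rw [etaStar_mul_self, neg_zero]
  refine V_end_ext fun x => ?_
  rw [LinearMap.neg_apply, Module.End.mul_apply, Module.End.mul_apply]
  by_cases hi : 2 * i ∈ x.entries <;> by_cases hj : 2 * j ∈ x.entries
  · rw [etaStar_single_of_mem hi, etaStar_single_of_mem hj, map_smul, map_smul,
      etaStar_single_of_mem (by simp [hi, hij]), etaStar_single_of_mem (by simp [hj, hij.symm]),
      FockBasis.erase_comm, smul_smul, smul_smul, ← neg_smul, FockBasis.entries_erase,
      FockBasis.entries_erase, fockSign_diff x.isFock_entries hi,
      fockSign_diff x.isFock_entries hj]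
    congr 1
    grind
  · rw [etaStar_single_of_mem hi, etaStar_single_of_notMem hj, map_zero, map_smul,
      etaStar_single_of_notMem (by simp [hj]), smul_zero, neg_zero]
  · rw [etaStar_single_of_notMem hi, etaStar_single_of_mem hj, map_zero, map_smul,
      etaStar_single_of_notMem (by simp [hi]), smul_zero, neg_zero]
  · rw [etaStar_single_of_notMem hi, etaStar_single_of_notMem hj, map_zero, map_zero, neg_zero]

theorem eta_mul_etaStar_of_ne {i j : ℤ} (hij : i ≠ j) :
    eta i * etaStar j = -(etaStar j * eta i) := by
  refine V_end_ext fun x => ?_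
  rw [LinearMap.neg_apply, Module.End.mul_apply, Module.End.mul_apply]
  by_cases hi : 2 * i ∈ x.entries <;> by_cases hj : 2 * j ∈ x.entries
  · rw [eta_single_of_mem hi, etaStar_single_of_mem hj, map_zero, map_smul,
      eta_single_of_mem (by simp [hi, hij]), smul_zero, neg_zero]
  · rw [eta_single_of_mem hi, etaStar_single_of_notMem hj, map_zero, map_zero, neg_zero]
  · rw [eta_single_of_notMem hi, etaStar_single_of_mem hj, map_smul, map_smul,
      eta_single_of_notMem (by simp [hi]), etaStar_single_of_mem (by simp [hj]),
      FockBasis.insert_erase_comm hij, smul_smul, smul_smul, ← neg_smul, FockBasis.entries_insert,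
      FockBasis.entries_erase, fockSign_insert x.isFock_entries hi,
      fockSign_diff x.isFock_entries hj]
    congr 1
    grind
  · rw [eta_single_of_notMem hi, etaStar_single_of_notMem hj, map_zero, map_smul,
      etaStar_single_of_notMem (by simp [hj, hij.symm]), smul_zero, neg_zero]

theorem eta_mul_etaStar_add (j : ℤ) : eta j * etaStar j + etaStar j * eta j = 1 := by
  refine V_end_ext fun x => ?_
  rw [LinearMap.add_apply, Module.End.mul_apply, Module.End.mul_apply, Module.End.one_apply]
  by_cases hj : 2 * j ∈ x.entries
  · rw [eta_single_of_mem hj, etaStar_single_of_mem hj, map_zero, map_smul,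
      eta_single_of_notMem (by simp), FockBasis.insert_erase_self hj, FockBasis.entries_erase,
      fockSign_diff x.isFock_entries hj, if_neg (lt_irrefl j), smul_smul, fockSign_mul_self,
      one_smul, add_zero]
  · rw [eta_single_of_notMem hj, etaStar_single_of_notMem hj, map_zero, map_smul,
      etaStar_single_of_mem (by simp), FockBasis.erase_insert_self hj, FockBasis.entries_insert,
      fockSign_insert x.isFock_entries hj, if_neg (lt_irrefl j), smul_smul, fockSign_mul_self,
      one_smul, zero_add]

theorem bV_two_mul (j : ℤ) : bV (2 * j) = eta j := by
  simp [bV]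

theorem bV_two_mul_sub_one (j : ℤ) : bV (2 * j - 1) = etaStar j + etaStar (j - 1) := by
  have : ¬ Even (2 * j - 1) := by simp
  simp [bV, this]

theorem exists_eq_two_mul_or_sub_one (m : ℤ) : ∃ j, m = 2 * j ∨ m = 2 * j - 1 :=
  ⟨(m + 1) / 2, by omega⟩

theorem bV_mul_self (m : ℤ) : bV m * bV m = 0 := by
  obtain ⟨j, rfl | rfl⟩ := exists_eq_two_mul_or_sub_one m
  · rw [bV_two_mul, eta_mul_self]
  · rw [bV_two_mul_sub_one, add_mul, mul_add, mul_add, etaStar_mul_self, etaStar_mul_self,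
      etaStar_mul_etaStar j (j - 1)]
    abel

theorem eta_mul_bV_of_lt {i j : ℤ} (h : 1 < |2 * i - (2 * j - 1)|) :
    bV (2 * i) * bV (2 * j - 1) = -(bV (2 * j - 1) * bV (2 * i)) := by
  have h₁ : i ≠ j := by rintro rfl; norm_num at h
  have h₂ : i ≠ j - 1 := by rintro rfl; ring_nf at h; norm_num at h
  rw [bV_two_mul, bV_two_mul_sub_one, mul_add, add_mul, eta_mul_etaStar_of_ne h₁,
    eta_mul_etaStar_of_ne h₂]
  abel

theorem bV_mul_bV (m l : ℤ) (h : 1 < |m - l|) : bV m * bV l = -(bV l * bV m) := by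
  obtain ⟨i, rfl | rfl⟩ := exists_eq_two_mul_or_sub_one m <;>
    obtain ⟨j, rfl | rfl⟩ := exists_eq_two_mul_or_sub_one l
  · rw [bV_two_mul, bV_two_mul, eta_mul_eta]
  · exact eta_mul_bV_of_lt h
  · rw [abs_sub_comm] at h
    rw [eta_mul_bV_of_lt h, neg_neg]
  · simp only [bV_two_mul_sub_one, add_mul, mul_add]
    rw [etaStar_mul_etaStar i j, etaStar_mul_etaStar i (j - 1), etaStar_mul_etaStar (i - 1) j,
      etaStar_mul_etaStar (i - 1) (j - 1)]
    abel

theorem bV_mul_bV_succ_add (m : ℤ) : bV m * bV (m + 1) + bV (m + 1) * bV m = 1 := by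
  obtain ⟨j, rfl | rfl⟩ := exists_eq_two_mul_or_sub_one m
  · rw [show 2 * j + 1 = 2 * (j + 1) - 1 by ring, bV_two_mul, bV_two_mul_sub_one,
      add_sub_cancel_right, mul_add, add_mul,
      eta_mul_etaStar_of_ne (show j ≠ j + 1 by omega), ← eta_mul_etaStar_add j]
    abel
  · rw [sub_add_cancel, bV_two_mul, bV_two_mul_sub_one, mul_add, add_mul,
      eta_mul_etaStar_of_ne (show j ≠ j - 1 by omega), ← eta_mul_etaStar_add j]
    abel

/-- there is a ℤ-algebra homomorphism `G : Cl_ℤ → End_ℤ(V)` with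
`G(a_{2j}) = η_j` and `G(a_{2j-1}) = η_j^* + η_{j-1}^*`; that is, the endomorphisms
`b_{2j} := η_j`, `b_{2j-1} := η_j^* + η_{j-1}^*` satisfy the defining relations of
`Cl_ℤ`. -/
theorem exists_fock_representation :
    (∃ G : ClZ →ₐ[ℤ] Module.End ℤ V,
        (∀ j : ℤ, G (a (2 * j)) = eta j) ∧
        (∀ j : ℤ, G (a (2 * j - 1)) = etaStar j + etaStar (j - 1))) ∧
    (∀ m : ℤ, bV m * bV m = 0) ∧
    (∀ m l : ℤ, 1 < |m - l| → bV m * bV l = -(bV l * bV m)) ∧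
    (∀ m : ℤ, bV m * bV (m + 1) + bV (m + 1) * bV m = 1) := by
  refine ⟨?_, bV_mul_self, bV_mul_bV, bV_mul_bV_succ_add⟩
  have hrel : ∀ ⦃x y : FreeAlgebra ℤ ℤ⦄, ClRel x y →
      FreeAlgebra.lift ℤ bV x = FreeAlgebra.lift ℤ bV y := by
    rintro _ _ (i | ⟨i, j, h⟩ | i)
    · simpa using bV_mul_self i
    · simpa using bV_mul_bV i j h
    · simpa using bV_mul_bV_succ_add i
  refine ⟨RingQuot.liftAlgHom ℤ ⟨FreeAlgebra.lift ℤ bV, hrel⟩, fun j => ?_, fun j => ?_⟩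
  · rw [a, RingQuot.liftAlgHom_mkAlgHom_apply, FreeAlgebra.lift_ι_apply, bV_two_mul]
  · rw [a, RingQuot.liftAlgHom_mkAlgHom_apply, FreeAlgebra.lift_ι_apply, bV_two_mul_sub_one]
end

section
/- The representation of Cl_ℤ on V is uniquely determined by its values on wedging generators and its annihilation of vacua: if ρ and ρ′ are ℤ-algebra homomorphisms Cl_ℤ → End_ℤ(V) such that ρ(a_{2j}) = η_j = ρ′(a_{2j}) for all j ∈ ℤ, and ρ(a_{2j−1})(|k⟩̄) = 0 = ρ′(a_{2j−1})(|k⟩̄) for all integers k ≥ j, then ρ = ρ′. -/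
/-!
Fock space `V`: free ℤ-module with basis the set `𝔹` of semi-infinite increasing
sequences of even integers.  A basis element is encoded by the set of its entries:
a set of even integers which is bounded below and contains every sufficiently
large even integer.  The wedging operator `eta j` inserts `2*j` (with sign
`(-1)^(number of entries below 2*j)`) and the contracting operator `etaStar j`
removes `2*j` (with the corresponding sign).
-/

open scoped Classical

/-- The vacuum state `|k⟩̄ = (2k+2) ∧ (2k+4) ∧ (2k+6) ∧ ⋯` of charge `k`,
encoded as the set of even integers `≥ 2k+2`. -/
def vac (k : ℤ) : FockBasis :=
  ⟨{m : ℤ | Even m ∧ 2 * k + 2 ≤ m},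
    ⟨fun _ hs => hs.1, ⟨2 * k + 2, fun _ hs => hs.2⟩, ⟨2 * k + 2, fun m hm hbm => ⟨hm, hbm⟩⟩⟩⟩

/-- Any two generators of `Cl_ℤ` have a scalar anticommutator. -/
theorem exists_anticommutator_eq (i j : ℤ) :
    ∃ c : ℤ, a i * a j + a j * a i = algebraMap ℤ ClZ c := by
  have adjacent (i : ℤ) : a i * a (i + 1) + a (i + 1) * a i = 1 := by
    simpa [a] using RingQuot.mkAlgHom_rel ℤ (ClRel.adjacent i)
  by_cases h : 1 < |i - j|
  · refine ⟨0, ?_⟩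
    have hij : a i * a j = -(a j * a i) := by
      simpa [a] using RingQuot.mkAlgHom_rel ℤ (ClRel.anticomm i j h)
    rw [hij, map_zero, neg_add_cancel]
  · obtain rfl | rfl | rfl : i = j ∨ j = i + 1 ∨ i = j + 1 := by
      rw [not_lt, abs_le] at h
      omega
    · refine ⟨0, ?_⟩
      have hi : a i * a i = 0 := by
        simpa [a] using RingQuot.mkAlgHom_rel ℤ (ClRel.sq i)
      rw [hi, map_zero, add_zero]
    · exact ⟨1, by rw [adjacent, map_one]⟩
    · exact ⟨1, by rw [add_comm, adjacent, map_one]⟩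

/-- A monomial containing `2 * j` is, up to sign, obtained by wedging `2 * j`
with the monomial in which it is removed. -/
theorem exists_single_eq_smul_eta (x : FockBasis) (j : ℤ) (hj : 2 * j ∈ x.1) :
    ∃ c : ℤ, Finsupp.single x (1 : ℤ) =
      c • eta j (Finsupp.single (⟨x.1 \ {2 * j}, x.2.diff j⟩ : FockBasis) 1) := by
  refine ⟨(-1) ^ {s ∈ x.1 \ {2 * j} | s < 2 * j}.ncard, ?_⟩
  have hx : (⟨insert (2 * j) (x.1 \ {2 * j}), (x.2.diff j).insert j⟩ : FockBasis) = x :=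
    Subtype.ext (Set.insert_sdiff_singleton.trans (Set.insert_eq_of_mem hj))
  have hsq (n : ℕ) (v : V) : v = (-1 : ℤ) ^ n • (-1 : ℤ) ^ n • v := by
    rw [smul_smul, ← mul_pow, neg_one_mul, neg_neg, one_pow, one_smul]
  have heta := Finsupp.linearCombination_single ℤ (1 : ℤ)
    (⟨x.1 \ {2 * j}, x.2.diff j⟩ : FockBasis) (v := fun x : FockBasis =>
      if 2 * j ∈ x.1 then 0
      else ((-1 : ℤ) ^ {s ∈ x.1 | s < 2 * j}.ncard) •
        Finsupp.single (⟨insert (2 * j) x.1, x.2.insert j⟩ : FockBasis) (1 : ℤ))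
  change eta j _ = _ at heta
  rw [heta, one_smul, if_neg (fun h => h.2 rfl), hx]
  exact hsq _ _

/-- An operator anticommuting with all wedging operators vanishes on every monomial
differing by finitely many wedges from a vacuum it annihilates. -/
theorem apply_single_eq_zero_of_anticommute_eta {D : Module.End ℤ V}
    (hD : ∀ n, D * eta n = -(eta n * D)) {k : ℤ}
    (hk : D (Finsupp.single (vac k) 1) = 0) (F : Finset ℤ) (x : FockBasis)
    (hx : (vac k).1 ⊆ x.1) (hF : x.1 \ (vac k).1 ⊆ F) :
    D (Finsupp.single x 1) = 0 := by
  induction F using Finset.induction_on generalizing x with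
  | empty =>
    have : x = vac k := Subtype.ext <| Set.Subset.antisymm
      (Set.sdiff_eq_empty.1 (Set.subset_empty_iff.1 (by simpa using hF))) hx
    rw [this, hk]
  | insert m F _ ih =>
    rw [Finset.coe_insert] at hF
    by_cases hm : m ∈ x.1 \ (vac k).1
    · obtain ⟨n, rfl⟩ := (x.2.1 m hm.1).two_dvd
      obtain ⟨c, hc⟩ := exists_single_eq_smul_eta x n hm.1
      have hy := ih ⟨x.1 \ {2 * n}, x.2.diff n⟩
        (fun s hs => ⟨hx hs, fun h => hm.2 (h ▸ hs)⟩)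
        (fun s hs => (hF ⟨hs.1.1, hs.2⟩).resolve_left hs.1.2)
      rw [hc, map_zsmul, ← Module.End.mul_apply, hD, LinearMap.neg_apply,
        Module.End.mul_apply, hy, map_zero, neg_zero, smul_zero]
    · exact ih x hx fun s hs => (hF hs).resolve_left fun h => hm (h ▸ hs)

/-- An operator anticommuting with all wedging operators and annihilating the vacua of
sufficiently large charge is zero. -/
theorem eq_zero_of_anticommute_eta {D : Module.End ℤ V} (j : ℤ)
    (hD : ∀ n, D * eta n = -(eta n * D))
    (hvac : ∀ k, j ≤ k → D (Finsupp.single (vac k) 1) = 0) : D = 0 := by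
  refine Finsupp.lhom_ext' fun x => LinearMap.ext_ring ?_
  obtain ⟨-, ⟨l, hl⟩, ⟨b, hb⟩⟩ := x.2
  have hfin : (x.1 \ (vac (max j |b|)).1).Finite := by
    refine (Set.finite_Icc l (2 * max j |b| + 2)).subset fun s hs => ⟨hl s hs.1, ?_⟩
    by_contra! h
    exact hs.2 ⟨x.2.1 s hs.1, h.le⟩
  refine apply_single_eq_zero_of_anticommute_eta hD (hvac _ (le_max_left _ _)) hfin.toFinset x
    (fun s hs => hb s hs.1 ?_) (Set.Finite.coe_toFinset hfin).ge
  have hs' : 2 * max j |b| + 2 ≤ s := hs.2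
  linarith [le_max_right j |b|, le_abs_self b, abs_nonneg b]

/-- the representation of `Cl_ℤ` on `V` is uniquely determined by its
values on wedging generators and its annihilation of vacua: any two ℤ-algebra
homomorphisms `Cl_ℤ → End_ℤ(V)` with `a_{2j} ↦ η_j` and with
`a_{2j-1} ↦` an operator killing `|k⟩̄` for all `k ≥ j` are equal. -/
theorem fock_representation_unique (ρ ρ' : ClZ →ₐ[ℤ] Module.End ℤ V)
    (heven : ∀ j : ℤ, ρ (a (2 * j)) = eta j)
    (heven' : ∀ j : ℤ, ρ' (a (2 * j)) = eta j)
    (hvac : ∀ j k : ℤ, j ≤ k → ρ (a (2 * j - 1)) (Finsupp.single (vac k) 1) = 0)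
    (hvac' : ∀ j k : ℤ, j ≤ k → ρ' (a (2 * j - 1)) (Finsupp.single (vac k) 1) = 0) :
    ρ = ρ' := by
  refine RingQuot.ringQuot_ext' _ _ _ (FreeAlgebra.hom_ext (funext fun i => ?_))
  change ρ (a i) = ρ' (a i)
  obtain ⟨m, rfl | rfl⟩ := Int.even_or_odd' i
  · rw [heven, heven']
  rw [← sub_eq_zero]
  refine eq_zero_of_anticommute_eta (m + 1) (fun n => ?_) fun k hk => ?_
  · obtain ⟨c, hc⟩ := exists_anticommutator_eq (2 * m + 1) (2 * n)
    have h := congrArg ρ hc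
    have h' := congrArg ρ' hc
    simp only [map_add, map_mul, AlgHom.commutes, heven, heven'] at h h'
    have h₂ := h.trans h'.symm
    rw [← sub_eq_zero] at h₂
    rw [eq_neg_iff_add_eq_zero, sub_mul, mul_sub, ← h₂]
    abel
  · have h := hvac (m + 1) k hk
    have h' := hvac' (m + 1) k hk
    rw [show 2 * (m + 1) - 1 = 2 * m + 1 by ring] at h h'
    rw [LinearMap.sub_apply, h, h', sub_zero]
end

section
/- In the complex Clifford algebra Cl, the elements b_{2i} := ψ_i^* and b_{2i−1} := ψ_i + ψ_{i−1} (for i ∈ ℤ) satisfy the defining relations of the integral Clifford algebra: b_m² = 0, b_m b_l = −b_l b_m whenever |m − l| > 1, and b_m b_{m+1} + b_{m+1} b_m = 1 for all m, l ∈ ℤ. Consequently there is a ring homomorphism θ : Cl_ℤ → Cl with θ(a_{2i}) = ψ_i^* and θ(a_{2i−1}) = ψ_i + ψ_{i−1} for all i ∈ ℤ. -/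
/-!
The complex Clifford algebra `Cl`: the ℂ-algebra with generators `ψ_j, ψ_j^*`
(`j : ℤ`) and the canonical anticommutation relations.
-/

/-- The defining relations of the complex Clifford algebra `Cl`. -/
inductive ClCRel : FreeAlgebra ℂ (ℤ ⊕ ℤ) → FreeAlgebra ℂ (ℤ ⊕ ℤ) → Prop
  | pc (i j : ℤ) : ClCRel
      (FreeAlgebra.ι ℂ (Sum.inl i) * FreeAlgebra.ι ℂ (Sum.inr j)
        + FreeAlgebra.ι ℂ (Sum.inr j) * FreeAlgebra.ι ℂ (Sum.inl i))
      (if i = j then 1 else 0)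
  | pp (i j : ℤ) : ClCRel
      (FreeAlgebra.ι ℂ (Sum.inl i) * FreeAlgebra.ι ℂ (Sum.inl j)
        + FreeAlgebra.ι ℂ (Sum.inl j) * FreeAlgebra.ι ℂ (Sum.inl i)) 0
  | cc (i j : ℤ) : ClCRel
      (FreeAlgebra.ι ℂ (Sum.inr i) * FreeAlgebra.ι ℂ (Sum.inr j)
        + FreeAlgebra.ι ℂ (Sum.inr j) * FreeAlgebra.ι ℂ (Sum.inr i)) 0

/-- The complex Clifford algebra `Cl`. -/
abbrev ClC : Type := RingQuot ClCRel

/-- The generator `ψ_j` of `Cl`. -/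
noncomputable def psi (j : ℤ) : ClC :=
  RingQuot.mkAlgHom ℂ ClCRel (FreeAlgebra.ι ℂ (Sum.inl j))

/-- The generator `ψ_j^*` of `Cl`. -/
noncomputable def psiStar (j : ℤ) : ClC :=
  RingQuot.mkAlgHom ℂ ClCRel (FreeAlgebra.ι ℂ (Sum.inr j))

open scoped Classical in
/-- The elements `b_m` of `Cl`: `b_{2i} = ψ_i^*` and `b_{2i-1} = ψ_i + ψ_{i-1}`. -/
noncomputable def bC (m : ℤ) : ClC :=
  if Even m then psiStar (m / 2) else psi ((m + 1) / 2) + psi ((m + 1) / 2 - 1)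

theorem psi_mul_psiStar_add (i j : ℤ) :
    psi i * psiStar j + psiStar j * psi i = if i = j then 1 else 0 := by
  have h := RingQuot.mkAlgHom_rel ℂ (ClCRel.pc i j)
  rw [map_add, map_mul, map_mul] at h
  refine h.trans ?_
  split_ifs <;> simp

theorem psi_mul_psi_add (i j : ℤ) : psi i * psi j + psi j * psi i = 0 := by
  have h := RingQuot.mkAlgHom_rel ℂ (ClCRel.pp i j)
  rwa [map_add, map_mul, map_mul, map_zero] at h

theorem psiStar_mul_psiStar_add (i j : ℤ) :
    psiStar i * psiStar j + psiStar j * psiStar i = 0 := by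
  have h := RingQuot.mkAlgHom_rel ℂ (ClCRel.cc i j)
  rwa [map_add, map_mul, map_mul, map_zero] at h

theorem eq_zero_of_add_self_eq_zero_ClC {x : ClC} (h : x + x = 0) : x = 0 := by
  rw [← two_smul ℂ x] at h
  exact (smul_eq_zero_iff_right (two_ne_zero : (2 : ℂ) ≠ 0)).mp h

theorem bC_two_mul (i : ℤ) : bC (2 * i) = psiStar i := by
  simp [bC]

theorem bC_two_mul_sub_one (i : ℤ) : bC (2 * i - 1) = psi i + psi (i - 1) := by
  have h : ¬ Even (2 * i - 1) := by
    rw [Int.not_even_iff_odd]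
    exact ⟨i - 1, by ring⟩
  simp [bC, h]

theorem exists_eq_two_mul_or_eq_two_mul_sub_one (m : ℤ) :
    ∃ i, m = 2 * i ∨ m = 2 * i - 1 :=
  ⟨(m + 1) / 2, by lia⟩

theorem psi_add_psi_anticommutator_psiStar (i j : ℤ) :
    (psi i + psi (i - 1)) * psiStar j + psiStar j * (psi i + psi (i - 1)) =
      (if i = j then 1 else 0) + (if i - 1 = j then 1 else 0) := by
  rw [← psi_mul_psiStar_add, ← psi_mul_psiStar_add]
  noncomm_ring

/-- The full table of anticommutators of the elements `b_m`. -/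
theorem bC_anticommutator (m l : ℤ) :
    bC m * bC l + bC l * bC m = if |m - l| = 1 then 1 else 0 := by
  simp only [abs_eq (zero_le_one' ℤ)]
  obtain ⟨i, rfl | rfl⟩ := exists_eq_two_mul_or_eq_two_mul_sub_one m <;>
  obtain ⟨j, rfl | rfl⟩ := exists_eq_two_mul_or_eq_two_mul_sub_one l
  · rw [bC_two_mul, bC_two_mul, psiStar_mul_psiStar_add, if_neg (by lia)]
  · rw [bC_two_mul, bC_two_mul_sub_one, add_comm, psi_add_psi_anticommutator_psiStar]
    split_ifs <;> first | (exfalso; lia) | simp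
  · rw [bC_two_mul, bC_two_mul_sub_one, psi_add_psi_anticommutator_psiStar]
    split_ifs <;> first | (exfalso; lia) | simp
  · rw [bC_two_mul_sub_one, bC_two_mul_sub_one, if_neg (by lia)]
    calc _ = (psi i * psi j + psi j * psi i)
          + (psi i * psi (j - 1) + psi (j - 1) * psi i)
          + (psi (i - 1) * psi j + psi j * psi (i - 1))
          + (psi (i - 1) * psi (j - 1) + psi (j - 1) * psi (i - 1)) := by noncomm_ring
      _ = 0 := by simp only [psi_mul_psi_add, add_zero]

theorem bC_mul_self (m : ℤ) : bC m * bC m = 0 :=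
  eq_zero_of_add_self_eq_zero_ClC (by simp [bC_anticommutator])

theorem bC_mul_eq_neg (m l : ℤ) (h : 1 < |m - l|) : bC m * bC l = -(bC l * bC m) :=
  eq_neg_of_add_eq_zero_left (by rw [bC_anticommutator, if_neg h.ne'])

theorem bC_mul_succ_add (m : ℤ) : bC m * bC (m + 1) + bC (m + 1) * bC m = 1 := by
  simp [bC_anticommutator]

theorem lift_bC_eq_of_ClRel ⦃x y : FreeAlgebra ℤ ℤ⦄ (h : ClRel x y) :
    FreeAlgebra.lift ℤ bC x = FreeAlgebra.lift ℤ bC y := by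
  cases h with
  | sq i => simp [bC_mul_self]
  | anticomm i j hij => simpa using bC_mul_eq_neg i j hij
  | adjacent i => simpa using bC_mul_succ_add i

/-- The homomorphism `Cl_ℤ → Cl` sending `a_m` to `b_m`. -/
noncomputable def clZToClC : ClZ →ₐ[ℤ] ClC :=
  RingQuot.liftAlgHom ℤ ⟨FreeAlgebra.lift ℤ bC, lift_bC_eq_of_ClRel⟩

theorem clZToClC_a (m : ℤ) : clZToClC (a m) = bC m := by
  rw [clZToClC, a, RingQuot.liftAlgHom_mkAlgHom_apply, FreeAlgebra.lift_ι_apply]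

/-- the elements `b_{2i} := ψ_i^*`, `b_{2i-1} := ψ_i + ψ_{i-1}` of the
complex Clifford algebra satisfy the defining relations of `Cl_ℤ`; consequently
there is a ring homomorphism `θ : Cl_ℤ → Cl` with `θ(a_{2i}) = ψ_i^*` and
`θ(a_{2i-1}) = ψ_i + ψ_{i-1}`. -/
theorem theta_exists :
    (∀ m : ℤ, bC m * bC m = 0) ∧
    (∀ m l : ℤ, 1 < |m - l| → bC m * bC l = -(bC l * bC m)) ∧
    (∀ m : ℤ, bC m * bC (m + 1) + bC (m + 1) * bC m = 1) ∧
    ∃ θ : ClZ →+* ClC,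
      (∀ i : ℤ, θ (a (2 * i)) = psiStar i) ∧
      (∀ i : ℤ, θ (a (2 * i - 1)) = psi i + psi (i - 1)) := by
  refine ⟨bC_mul_self, bC_mul_eq_neg, bC_mul_succ_add, clZToClC.toRingHom,
    fun i => ?_, fun i => ?_⟩
  · exact (clZToClC_a _).trans (bC_two_mul i)
  · exact (clZToClC_a _).trans (bC_two_mul_sub_one i)
end

section
/- Let k ∈ ℤ, let N ≥ 1, and let x, y : ℤ_{≥1} → ℤ be sequences of even integers such that x_n = y_n = 2n + 2k for all n ≥ N and x_i < 2N + 2k for all i < N. Then every bijection σ : ℤ_{≥1} → ℤ_{≥1} satisfying y_{σ(i)} ≤ x_i for all i ≥ 1 satisfies σ(n) = n for all n ≥ N. In particular, the set of bijections σ of ℤ_{≥1} with y_{σ(i)} ≤ x_i for all i is finite. -/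
/-- A permutation of `ℕ+` that maps every initial segment `{i | i < m}` with `N ≤ m` into itself
fixes all `n ≥ N`. -/
theorem PNat.perm_eq_self_of_mapsTo_Iio {N : ℕ+} (σ : Equiv.Perm ℕ+)
    (h : ∀ m, N ≤ m → Set.MapsTo σ (Set.Iio m) (Set.Iio m)) {n : ℕ+} (hn : N ≤ n) :
    σ n = n := by
  have hle : σ n ≤ n :=
    PNat.lt_add_one_iff.1 (h (n + 1) (hn.trans (PNat.lt_add_right n 1).le)
      (PNat.lt_add_right n 1))
  refine hle.eq_of_not_lt fun hlt => ?_
  obtain ⟨j, hj, hjn⟩ :=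
    (((Set.finite_Iio n).injOn_iff_bijOn_of_mapsTo (h n hn)).1
      σ.injective.injOn).surjOn hlt
  exact hj.ne (σ.injective hjn)

/-- let `k ∈ ℤ`, `N ≥ 1`, and let `x, y : ℤ_{≥1} → ℤ` be sequences of
even integers with `x_n = y_n = 2n + 2k` for all `n ≥ N` and `x_i < 2N + 2k` for
`i < N`.  Then every bijection `σ` of `ℤ_{≥1}` with `y_{σ(i)} ≤ x_i` for all `i`
fixes all `n ≥ N`; in particular the set of such bijections is finite. -/
theorem matchings_finite (k : ℤ) (N : ℕ+) (x y : ℕ+ → ℤ)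
    (hxe : ∀ n, Even (x n)) (hye : ∀ n, Even (y n))
    (hxt : ∀ n, N ≤ n → x n = 2 * (n : ℤ) + 2 * k)
    (hyt : ∀ n, N ≤ n → y n = 2 * (n : ℤ) + 2 * k)
    (hxb : ∀ i, i < N → x i < 2 * (N : ℤ) + 2 * k) :
    (∀ σ : ℕ+ ≃ ℕ+, (∀ i, y (σ i) ≤ x i) → ∀ n, N ≤ n → σ n = n) ∧
    {σ : ℕ+ ≃ ℕ+ | ∀ i, y (σ i) ≤ x i}.Finite := by
  have hmaps : ∀ σ : ℕ+ ≃ ℕ+, (∀ i, y (σ i) ≤ x i) →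
      ∀ m, N ≤ m → Set.MapsTo σ (Set.Iio m) (Set.Iio m) := by
    intro σ hσ m hm i hi
    rw [Set.mem_Iio] at hi ⊢
    by_contra! hmi
    have hy := hyt _ (hm.trans hmi)
    have hyx := hσ i
    have hm' : (N : ℤ) ≤ m := by exact_mod_cast hm
    have hmi' : (m : ℤ) ≤ σ i := by exact_mod_cast hmi
    have hi' : (i : ℤ) < m := by exact_mod_cast hi
    rcases lt_or_ge i N with hiN | hiN
    · have := hxb i hiN
      linarith
    · have := hxt i hiN
      linarith
  have hfix : ∀ σ : ℕ+ ≃ ℕ+, (∀ i, y (σ i) ≤ x i) → ∀ n, N ≤ n → σ n = n :=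
    fun σ hσ _ hn => PNat.perm_eq_self_of_mapsTo_Iio σ (hmaps σ hσ) hn
  refine ⟨hfix, Set.Finite.of_injOn (f := fun σ (i : Set.Iio N) => σ i)
    (t := {f | ∀ i, f i ∈ Set.Iio N}) ?_ ?_ (Set.Finite.pi' fun _ => Set.finite_Iio N)⟩
  · exact fun σ hσ i => hmaps σ hσ N le_rfl i.2
  · intro σ hσ τ hτ hστ
    ext1 i
    rcases lt_or_ge i N with hi | hi
    · exact congrFun hστ ⟨i, hi⟩
    · rw [hfix σ hσ i hi, hfix τ hτ i hi]
end

section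
/- Let k ∈ ℤ and let x = (x_1, x_2, …) be a sequence of even integers with x_n = 2n + 2k for all sufficiently large n. If the entries of x are pairwise distinct (x_i ≠ x_j for i ≠ j), then the energy of x is nonnegative: for every N such that x_n = 2n + 2k for all n > N, one has ∑_{i=1}^{N} (2k + 2i − x_i) ≥ 0. Equivalently, a sequence of negative energy must contain a repeated entry. -/
/-- A finite set of integers bounded above by `M` has sum at most `1 + 2 + ⋯ + M`. -/
theorem Int.sum_le_sum_Icc_one_of_forall_le (S : Finset ℤ) (M : ℤ) (hS : ∀ a ∈ S, a ≤ M) :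
    ∑ a ∈ S, a ≤ ∑ a ∈ Finset.Icc 1 M, a := by
  have hneg : ∑ a ∈ S \ Finset.Icc 1 M, a ≤ 0 := by
    refine Finset.sum_nonpos fun a ha => ?_
    rw [Finset.mem_sdiff, Finset.mem_Icc] at ha
    have := hS a ha.1
    by_contra! h
    exact ha.2 ⟨h, this⟩
  have hpos : ∑ a ∈ S ∩ Finset.Icc 1 M, a ≤ ∑ a ∈ Finset.Icc 1 M, a := by
    refine Finset.sum_le_sum_of_subset_of_nonneg Finset.inter_subset_right fun a ha _ => ?_
    have := (Finset.mem_Icc.mp ha).1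
    omega
  rw [← Finset.sum_inter_add_sum_sdiff S (Finset.Icc 1 M)]
  linarith

/-- let `k ∈ ℤ` and let `x` be a sequence (indexed by `n ≥ 1`) of
even integers with pairwise distinct entries.  Then for every `N` such that
`x_n = 2n + 2k` for all `n > N`, the energy sum `∑_{i=1}^N (2k + 2i - x_i)` is
nonnegative.  (Equivalently, a sequence of negative energy has a repeated entry.) -/
theorem energy_nonneg_of_distinct (k : ℤ) (x : ℕ → ℤ)
    (hxe : ∀ n, 1 ≤ n → Even (x n))
    (hinj : ∀ i j, 1 ≤ i → 1 ≤ j → x i = x j → i = j)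
    (N : ℕ) (htail : ∀ n, N < n → x n = 2 * (n : ℤ) + 2 * k) :
    0 ≤ ∑ i ∈ Finset.Icc 1 N, (2 * k + 2 * (i : ℤ) - x i) := by
  have hx : ∀ n, 1 ≤ n → ∃ y : ℤ, x n = 2 * y + 2 * k := fun n hn => by
    obtain ⟨r, hr⟩ := hxe n hn
    exact ⟨r - k, by omega⟩
  choose! y hy using hx
  have hyinj : Set.InjOn y (Finset.Icc 1 N : Finset ℕ) := fun i hi j hj hij => by
    have hi1 := (Finset.mem_Icc.mp hi).1
    have hj1 := (Finset.mem_Icc.mp hj).1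
    exact hinj i j hi1 hj1 (by rw [hy i hi1, hy j hj1, hij])
  have hyle : ∀ i ∈ Finset.Icc 1 N, y i ≤ N := fun i hi => by
    obtain ⟨hi1, hiN⟩ := Finset.mem_Icc.mp hi
    by_contra! h
    have htoNat : N < (y i).toNat := by omega
    have := hinj i (y i).toNat hi1 (by omega) (by rw [hy i hi1, htail _ htoNat]; omega)
    omega
  have hle := Int.sum_le_sum_Icc_one_of_forall_le ((Finset.Icc 1 N).image y) N
    (by simpa only [Finset.forall_mem_image] using hyle)
  rw [Finset.sum_image hyinj] at hle
  have hcast : ∑ a ∈ Finset.Icc (1 : ℤ) N, a = ∑ i ∈ Finset.Icc 1 N, (i : ℤ) := by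
    symm
    refine Finset.sum_bij (fun i _ => (i : ℤ)) ?_ ?_ ?_ ?_
    · intro i hi
      simp only [Finset.mem_Icc] at hi ⊢
      omega
    · intro i _ j _ hij
      exact_mod_cast hij
    · intro a ha
      rw [Finset.mem_Icc] at ha
      exact ⟨a.toNat, Finset.mem_Icc.mpr (by omega), by omega⟩
    · intro i _
      rfl
  have hsum : ∑ i ∈ Finset.Icc 1 N, (2 * k + 2 * (i : ℤ) - x i)
      = 2 * (∑ i ∈ Finset.Icc 1 N, (i : ℤ) - ∑ i ∈ Finset.Icc 1 N, y i) := by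
    rw [← Finset.sum_sub_distrib, Finset.mul_sum]
    refine Finset.sum_congr rfl fun i hi => ?_
    rw [hy i (Finset.mem_Icc.mp hi).1]
    ring
  rw [hsum]
  linarith
end
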